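/- arXiv:0709.3182 — 3 statements merged into one kernel-verified Lean document; each statement's English description precedes it below -/
import Mathlib

section
/- Let (R, n) be a regular local ring, I ⊆ n² an ideal such that A = R/I is Artinian with maximal ideal m = n/I, embedding dimension h, and multiplicity (length) e. Then binom(h+1, 2) − v(m²) ≤ v(I), where v denotes the minimal number of generators. -/
open IsLocalRing

/-- The minimal number of generators of a submodule. -/
noncomputable def minGen {R M : Type*} [Ring R] [AddCommGroup M] [Module R M]
    (N : Submodule R M) : ℕ :=
  sInf {n | ∃ s : Finset M, s.card = n ∧ Submodule.span R (s : Set M) = N}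

theorem minGen_spec {R M : Type*} [Ring R] [AddCommGroup M] [Module R M]
    (N : Submodule R M) (hN : N.FG) :
    ∃ s : Finset M, s.card = minGen N ∧ Submodule.span R (s : Set M) = N := by
  have : (sInf {n | ∃ s : Finset M, s.card = n ∧ Submodule.span R (s : Set M) = N}) ∈
      {n | ∃ s : Finset M, s.card = n ∧ Submodule.span R (s : Set M) = N} := by
    apply Nat.sInf_mem
    obtain ⟨s, hs⟩ := hN
    exact ⟨s.card, s, rfl, hs⟩
  exact this

/-- If `F` is a quadratic form with `F(x) ∈ n * n²` and `F(e)` is a unit where `e i = 1`,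
then the dimension is less than the number of variables. -/
theorem key_dim (R : Type*) [CommRing R] [IsLocalRing R] [IsNoetherianRing R]
    {ι : Type*} [Fintype ι] [DecidableEq ι] (x : ι → R)
    (hx : Ideal.span (Set.range x) = maximalIdeal R)
    (hdim : ringKrullDim R = (Fintype.card ι : ℕ))
    (c : Sym2 ι → R)
    (hc : ∑ s, c s * (s.map x).mul ∈ maximalIdeal R * maximalIdeal R ^ 2)
    (e : ι → R) (i : ι) (hi : e i = 1) : ∑ s, c s * (s.map e).mul ∈ maximalIdeal R := by
  classical
  by_contra hu
  have hu' : IsUnit (∑ s, c s * (s.map e).mul) := by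
    simpa using hu
  have hxm : ∀ k, x k ∈ maximalIdeal R := fun k => hx ▸ Ideal.subset_span ⟨k, rfl⟩
  let T : Finset R := (Finset.univ.erase i).image (fun k => x k - e k * x i)
  let J : Ideal R := Ideal.span (T : Set R)
  have hTcard : T.card < Fintype.card ι :=
    Finset.card_image_le.trans_lt (Finset.card_erase_lt_of_mem (Finset.mem_univ i))
  have hJm : J ≤ maximalIdeal R := by
    refine Ideal.span_le.2 fun y hy => ?_
    obtain ⟨k, -, rfl⟩ := Finset.mem_image.1 (Finset.mem_coe.1 hy)
    exact sub_mem (hxm k) (Ideal.mul_mem_left _ _ (hxm i))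
  have hJx : ∀ k, x k - e k * x i ∈ J := by
    intro k
    by_cases hk : k = i
    · subst hk; simp [hi]
    · exact Ideal.subset_span (Finset.mem_coe.2 (Finset.mem_image.2 ⟨k, by simp [hk], rfl⟩))
  have hq : ∀ k, Ideal.Quotient.mk J (x k) =
      Ideal.Quotient.mk J (e k) * Ideal.Quotient.mk J (x i) := by
    intro k
    rw [← map_mul]
    exact Ideal.Quotient.eq.2 (hJx k)
  have hqs : ∀ s : Sym2 ι, Ideal.Quotient.mk J ((s.map x).mul) =
      Ideal.Quotient.mk J ((s.map e).mul) * Ideal.Quotient.mk J (x i) ^ 2 := by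
    intro s
    induction s with
    | _ a b =>
      simp only [Sym2.map_mk, Sym2.mul_mk, map_mul, hq a, hq b]
      ring
  have hF : (∑ s, c s * (s.map x).mul) - (∑ s, c s * (s.map e).mul) * x i ^ 2 ∈ J := by
    rw [← Ideal.Quotient.eq]
    simp only [map_sum, map_mul, map_pow, hqs, Finset.sum_mul, mul_assoc]
  have hxi : x i ^ 2 ∈ J ⊔ maximalIdeal R • maximalIdeal R ^ 2 := by
    obtain ⟨u, hu⟩ := hu'
    have h1 : (∑ s, c s * (s.map e).mul) * x i ^ 2 ∈
        J ⊔ maximalIdeal R • maximalIdeal R ^ 2 := by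
      have := sub_mem (Ideal.mem_sup_right (S := J) hc) (Ideal.mem_sup_left
        (T := maximalIdeal R * maximalIdeal R ^ 2) hF)
      simpa using this
    rw [← hu] at h1
    simpa using Ideal.mul_mem_left _ (↑u⁻¹ : R) h1
  have hn : maximalIdeal R ^ 2 ≤ J ⊔ maximalIdeal R • maximalIdeal R ^ 2 := by
    conv_lhs => rw [pow_two, ← hx, Ideal.span_mul_span']
    refine Ideal.span_le.2 ?_
    rintro _ ⟨_, ⟨a, rfl⟩, _, ⟨b, rfl⟩, rfl⟩
    have h1 : x a * x b - e a * e b * x i ^ 2 ∈ J := by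
      rw [← Ideal.Quotient.eq]
      simp only [map_mul, map_pow, hq a, hq b]
      ring
    have := add_mem (Ideal.mem_sup_left (T := maximalIdeal R • maximalIdeal R ^ 2) h1)
      (Ideal.mul_mem_left _ (e a * e b) hxi)
    simpa using this
  have hnJ : maximalIdeal R ^ 2 ≤ J :=
    Submodule.le_of_le_smul_of_le_jacobson_bot (IsNoetherian.noetherian _)
      (IsLocalRing.maximalIdeal_le_jacobson _) hn
  have hmin : maximalIdeal R ∈ (Ideal.span (T : Set R)).minimalPrimes := by
    refine ⟨⟨inferInstance, hJm⟩, fun p hp _ => ?_⟩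
    exact hp.1.le_of_pow_le (hnJ.trans hp.2)
  have hht := Ideal.height_le_card_of_mem_minimalPrimes_span_finset hmin
  have h2 := IsLocalRing.maximalIdeal_height_eq_ringKrullDim (R := R)
  rw [hdim] at h2
  have h3 : (maximalIdeal R).height = (Fintype.card ι : ℕ) := by exact_mod_cast h2
  rw [h3] at hht
  have : Fintype.card ι ≤ T.card := by exact_mod_cast hht
  omega

theorem key_coeff (R : Type*) [CommRing R] [IsLocalRing R] [IsNoetherianRing R]
    {ι : Type*} [Fintype ι] [DecidableEq ι] (x : ι → R)
    (hx : Ideal.span (Set.range x) = maximalIdeal R)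
    (hdim : ringKrullDim R = (Fintype.card ι : ℕ))
    (c : Sym2 ι → R)
    (hc : ∑ s, c s * (s.map x).mul ∈ maximalIdeal R * maximalIdeal R ^ 2)
    (s : Sym2 ι) : c s ∈ maximalIdeal R := by
  have hdiag : ∀ i, c s(i, i) ∈ maximalIdeal R := by
    intro i
    have := key_dim R x hx hdim c hc (Pi.single i 1) i (by simp)
    rw [Finset.sum_eq_single s(i, i)] at this
    · simpa using this
    · intro b _ hb
      induction b with
      | _ a b =>
        have : a ≠ i ∨ b ≠ i := by
          by_contra! h
          exact hb (by rw [h.1, h.2])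
        rcases this with h | h <;> simp [Pi.single_apply, h]
    · simp
  induction s with
  | _ i j =>
    by_cases hij : i = j
    · subst hij; exact hdiag i
    have := key_dim R x hx hdim c hc (fun k => if k = i ∨ k = j then 1 else 0) i (by simp)
    rw [← Finset.sum_subset (Finset.subset_univ {s(i, i), s(i, j), s(j, j)})] at this
    · rw [Finset.sum_insert, Finset.sum_insert, Finset.sum_singleton] at this
      · simp at this
        have h2 := sub_mem (sub_mem this (hdiag i)) (hdiag j)
        convert h2 using 1
        ring
      · simp [hij]
      · simp [hij]
    · intro b _ hb
      induction b with
      | _ a b =>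
        by_cases ha : a = i ∨ a = j
        · by_cases hb' : b = i ∨ b = j
          · exfalso
            apply hb
            rcases ha with rfl | rfl <;> rcases hb' with rfl | rfl <;> simp [Sym2.eq_swap]
          · simp [hb']
        · simp [ha]

theorem card_le_of_span (R : Type*) [CommRing R] [IsLocalRing R] [IsNoetherianRing R]
    {ι : Type*} [Fintype ι] [DecidableEq ι] (x : ι → R)
    (hx : Ideal.span (Set.range x) = maximalIdeal R)
    (hdim : ringKrullDim R = (Fintype.card ι : ℕ))
    (T : Finset R) (hT : Ideal.span (T : Set R) = maximalIdeal R ^ 2) :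
    (Fintype.card ι + 1).choose 2 ≤ T.card := by
  by_contra! hlt
  have hxm : ∀ k, x k ∈ maximalIdeal R := fun k => hx ▸ Ideal.subset_span ⟨k, rfl⟩
  have hmem : ∀ s : Sym2 ι, ∃ a : R → R, ∑ t ∈ T, a t * t = (s.map x).mul := by
    intro s
    have : (s.map x).mul ∈ Ideal.span (T : Set R) := by
      rw [hT]
      induction s with
      | _ a b =>
        simp only [Sym2.map_mk, Sym2.mul_mk, pow_two]
        exact Ideal.mul_mem_mul (hxm a) (hxm b)
    obtain ⟨f, -, hf⟩ := Submodule.mem_span_finset.1 this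
    exact ⟨f, by simpa using hf⟩
  choose a ha using hmem
  let f : (Sym2 ι → ResidueField R) →ₗ[ResidueField R] (T → ResidueField R) :=
    Matrix.toLin' (Matrix.of fun (t : T) s => residue R (a s t))
  have hker : LinearMap.ker f ≠ ⊥ := by
    apply LinearMap.ker_ne_bot_of_finrank_lt
    have : Fintype.card (Sym2 ι) = (Fintype.card ι + 1).choose 2 := by
      rw [← Finset.card_univ, ← Finset.sym2_univ, Finset.card_sym2, Finset.card_univ]
    simpa [this] using hlt
  obtain ⟨v, hv, hv0⟩ := (Submodule.ne_bot_iff _).1 hker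
  have hlift : ∀ s, ∃ r, residue R r = v s := fun s => residue_surjective (v s)
  choose c hc using hlift
  apply hv0
  funext s
  rw [← hc s, Pi.zero_apply, residue_eq_zero_iff]
  refine key_coeff R x hx hdim c ?_ s
  have h1 : ∑ s, c s * (s.map x).mul = ∑ t ∈ T, (∑ s, c s * a s t) * t := by
    simp only [← ha, Finset.mul_sum, Finset.sum_mul]
    rw [Finset.sum_comm]
    simp only [mul_assoc]
  rw [h1]
  refine sum_mem fun t ht => Ideal.mul_mem_mul ?_ (hT ▸ Ideal.subset_span ht)
  rw [← residue_eq_zero_iff]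
  have := congrFun (LinearMap.mem_ker.1 hv) ⟨t, ht⟩
  simp only [f, Matrix.toLin'_apply, Matrix.mulVec, dotProduct, Matrix.of_apply,
    Pi.zero_apply] at this
  simp only [map_sum, map_mul, hc]
  rw [← this]
  exact Finset.sum_congr rfl fun s _ => mul_comm _ _

/-- If `(R,n)` is a regular local ring of dimension `h`,
`I ⊆ n²` and `A = R/I` is Artinian with maximal ideal `m`, then
`binom(h+1,2) − v(m²) ≤ v(I)`. -/
theorem lower_bound_vI
    (R : Type*) [CommRing R] [IsLocalRing R] [IsNoetherianRing R]
    (h : ℕ)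
    (hreg : ∃ s : Finset R, s.card = h ∧ Ideal.span (s : Set R) = maximalIdeal R)
    (hdim : ringKrullDim R = h)
    (I : Ideal R) (hI : I ≤ (maximalIdeal R) ^ 2)
    (hart : IsArtinianRing (R ⧸ I)) [IsLocalRing (R ⧸ I)] :
    Nat.choose (h + 1) 2 - minGen ((maximalIdeal (R ⧸ I)) ^ 2) ≤ minGen I := by
  classical
  haveI : IsNoetherianRing (R ⧸ I) := inferInstance
  obtain ⟨s, hs, hspan⟩ := hreg
  obtain ⟨S, hS, hSI⟩ := minGen_spec I (IsNoetherian.noetherian _)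
  obtain ⟨U, hU, hUm⟩ := minGen_spec ((maximalIdeal (R ⧸ I)) ^ 2) (IsNoetherian.noetherian _)
  have hsurj := Ideal.Quotient.mk_surjective (I := I)
  have hcomap : (maximalIdeal (R ⧸ I)).comap (Ideal.Quotient.mk I) = maximalIdeal R :=
    eq_maximalIdeal (Ideal.comap_isMaximal_of_surjective _ hsurj)
  have hmap : (maximalIdeal R ^ 2).map (Ideal.Quotient.mk I) = maximalIdeal (R ⧸ I) ^ 2 := by
    rw [Ideal.map_pow, ← hcomap, Ideal.map_comap_of_surjective _ hsurj]
  let g := Function.surjInv hsurj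
  have hg : ∀ y, Ideal.Quotient.mk I (g y) = y := Function.surjInv_eq hsurj
  have hgen : Ideal.span ((U.image g ∪ S : Finset R) : Set R) = maximalIdeal R ^ 2 := by
    have h1 : (Ideal.span ((U.image g : Finset R) : Set R)).map (Ideal.Quotient.mk I) =
        maximalIdeal (R ⧸ I) ^ 2 := by
      rw [Ideal.map_span, Finset.coe_image, Set.image_image]
      simp only [hg, Set.image_id']
      exact hUm
    have h2 := congrArg (Ideal.comap (Ideal.Quotient.mk I)) (h1.trans hmap.symm)
    rw [Ideal.comap_map_of_surjective _ hsurj, Ideal.comap_map_of_surjective _ hsurj,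
      ← RingHom.ker_eq_comap_bot, Ideal.mk_ker, sup_eq_left.2 hI] at h2
    rw [Finset.coe_union, Ideal.span_union, ← h2]
    congr 1
  have hle := card_le_of_span R (fun k : s => (k : R)) (by simpa using hspan)
    (by simpa [hs] using hdim) _ hgen
  have h3 := Finset.card_union_le (U.image g) S
  have h4 := Finset.card_image_le (s := U) (f := g)
  rw [Fintype.card_coe, hs] at hle
  omega
end

section
/- Let k be a field with a ∈ k and w ∈ k nonzero, B = k[X₁, X₂], s = t+1 with t ≥ 2, and Q = X₂² − a·X₁·X₂ − w·X₁². Then Q, X₁^t·X₂ is a regular sequence in B, and B/(Q, X₁^t X₂) has Hilbert function 1, 2, 2, …, 2, 1, 0 (value 2 in degrees 1 through t, value 1 in degree t+1, zero afterwards). Moreover X₁² ∈ (Q, X₂), hence X₁^{t+2} ∈ (Q, X₁^t X₂). -/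
open MvPolynomial

/-- The Hilbert function of `k[X₁,X₂]/K` in degree `n`:
`dim_k S_n − dim_k K_n`. -/
noncomputable def hilbFn (k : Type*) [Field k] (K : Ideal (MvPolynomial (Fin 2) k)) (n : ℕ) : ℕ :=
  Module.finrank k (homogeneousSubmodule (Fin 2) k n) -
    Module.finrank k
      (Submodule.restrictScalars k K ⊓ homogeneousSubmodule (Fin 2) k n : Submodule k _)


section Helpers

/-- Rank-nullity criterion for the Hilbert function. -/
lemma hilbFn_eq_of_map (k : Type*) [Field k] (K : Ideal (MvPolynomial (Fin 2) k)) (n : ℕ)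
    {V : Type*} [AddCommGroup V] [Module k V] [Module.Finite k V]
    (f : MvPolynomial (Fin 2) k →ₗ[k] V)
    (hker : ∀ p ∈ homogeneousSubmodule (Fin 2) k n, p ∈ K ↔ f p = 0)
    (hsurj : ∀ v, ∃ p ∈ homogeneousSubmodule (Fin 2) k n, f p = v) :
    hilbFn k K n = Module.finrank k V := by
  unfold hilbFn
  set S := homogeneousSubmodule (Fin 2) k n with hS
  have : Module.Finite k S := Module.Finite.iff_fg.mpr (homogeneousSubmodule_fg (Fin 2) k n)
  have h1 := LinearMap.finrank_range_add_finrank_ker (f.domRestrict S)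
  have h2 : LinearMap.range (f.domRestrict S) = ⊤ := by
    rw [LinearMap.range_eq_top]
    intro v
    obtain ⟨p, hp, rfl⟩ := hsurj v
    exact ⟨⟨p, hp⟩, rfl⟩
  have h3 : (Submodule.restrictScalars k K ⊓ S : Submodule k _)
      = (LinearMap.ker (f.domRestrict S)).map S.subtype := by
    ext p
    simp only [Submodule.mem_inf, Submodule.restrictScalars_mem, Submodule.mem_map,
      LinearMap.mem_ker, Submodule.subtype_apply]
    constructor
    · rintro ⟨h, hp⟩
      exact ⟨⟨p, hp⟩, (hker p hp).1 h, rfl⟩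
    · rintro ⟨⟨q, hq⟩, h, rfl⟩
      exact ⟨(hker q hq).2 h, hq⟩
  have h4 := (Submodule.equivMapOfInjective S.subtype S.injective_subtype
    (LinearMap.ker (f.domRestrict S))).finrank_eq
  rw [h2, finrank_top] at h1
  rw [h3, ← h4]
  omega

variable {k : Type*} [Field k]

/-- Homogeneous polynomials in two variables are spanned by monomials. -/
lemma homog_le (n : ℕ) (M : Submodule k (MvPolynomial (Fin 2) k))
    (h : ∀ i m : ℕ, i + m = n → (X 0 ^ i * X 1 ^ m : MvPolynomial (Fin 2) k) ∈ M) :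
    homogeneousSubmodule (Fin 2) k n ≤ M := by
  intro p hp
  rw [mem_homogeneousSubmodule] at hp
  rw [p.as_sum]
  refine Submodule.sum_mem _ fun d hd => ?_
  have hdeg := hp (mem_support_iff.1 hd)
  have h2 : d 0 + d 1 = n := by
    rw [← hdeg]; simp [Finsupp.weight_apply, Finsupp.sum_fintype]
  have := M.smul_mem (coeff d p) (h _ _ h2)
  convert this using 1
  rw [monomial_eq, smul_eq_C_mul, Finsupp.prod_fintype _ _ (by simp)]
  simp

lemma Y_pow_mod (a w : k) (m : ℕ) : ∃ α β : k,
    (X 1 ^ 2 - C a * X 0 * X 1 - C w * X 0 ^ 2 : MvPolynomial (Fin 2) k) ∣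
      X 1 ^ (m + 1) - (C α * X 0 ^ (m + 1) + C β * (X 0 ^ m * X 1)) := by
  induction m with
  | zero => exact ⟨0, 1, by simp⟩
  | succ m ih =>
    obtain ⟨α, β, c, hc⟩ := ih
    refine ⟨β * w, α + β * a, X 1 * c + C β * X 0 ^ m, ?_⟩
    simp only [C_mul, C_add]
    linear_combination X 1 * hc

lemma homog_decomp (a w : k) (n : ℕ) (p : MvPolynomial (Fin 2) k)
    (hp : p ∈ homogeneousSubmodule (Fin 2) k (n + 1)) : ∃ α β : k,
    (X 1 ^ 2 - C a * X 0 * X 1 - C w * X 0 ^ 2 : MvPolynomial (Fin 2) k) ∣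
      p - (C α * X 0 ^ (n + 1) + C β * (X 0 ^ n * X 1)) := by
  let M : Submodule k (MvPolynomial (Fin 2) k) :=
    { carrier := {p | ∃ α β : k,
        (X 1 ^ 2 - C a * X 0 * X 1 - C w * X 0 ^ 2 : MvPolynomial (Fin 2) k) ∣
          p - (C α * X 0 ^ (n + 1) + C β * (X 0 ^ n * X 1))}
      zero_mem' := ⟨0, 0, by simp⟩
      add_mem' := by
        rintro p q ⟨α, β, c, h⟩ ⟨α', β', c', h'⟩
        refine ⟨α + α', β + β', c + c', ?_⟩
        simp only [C_add]
        linear_combination h + h'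
      smul_mem' := by
        rintro r p ⟨α, β, c, h⟩
        refine ⟨r * α, r * β, C r * c, ?_⟩
        simp only [C_mul, smul_eq_C_mul]
        linear_combination C r * h }
  refine homog_le (n + 1) M ?_ hp
  intro i m him
  cases m with
  | zero =>
    refine ⟨1, 0, 0, ?_⟩
    have : i = n + 1 := by omega
    subst this
    simp
  | succ m =>
    obtain ⟨α, β, c, hc⟩ := Y_pow_mod a w m
    have : n = i + m := by omega
    subst this
    refine ⟨α, β, X 0 ^ i * c, ?_⟩
    linear_combination X 0 ^ i * hc

lemma homog_zero (p : MvPolynomial (Fin 2) k)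
    (hp : p ∈ homogeneousSubmodule (Fin 2) k 0) : ∃ α : k, p = C α := by
  rw [homogeneousSubmodule_zero, Submodule.mem_one] at hp
  obtain ⟨α, rfl⟩ := hp
  exact ⟨α, rfl⟩

/-- The map `k[x,y] → k[x][ω]`, `ω² = a x ω + w x²`. -/
noncomputable def phi (a w : k) : MvPolynomial (Fin 2) k →ₐ[k]
    QuadraticAlgebra (Polynomial k) (Polynomial.C w * Polynomial.X ^ 2)
      (Polynomial.C a * Polynomial.X) :=
  aeval ![QuadraticAlgebra.C Polynomial.X, ⟨0, 1⟩]

lemma phi_X0_pow (a w : k) (n : ℕ) :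
    phi a w (X 0 ^ n) = ⟨Polynomial.X ^ n, 0⟩ := by
  simp only [phi, map_pow, aeval_X, Matrix.cons_val_zero, ← QuadraticAlgebra.C_pow]
  rfl

lemma phi_X1 (a w : k) : phi a w (X 1) = ⟨0, 1⟩ := by
  simp [phi]

lemma phi_C (a w r : k) : phi a w (C r) = ⟨Polynomial.C r, 0⟩ := by
  simp only [phi, aeval_C]
  rfl

lemma phi_Q (a w : k) :
    phi a w (X 1 ^ 2 - C a * X 0 * X 1 - C w * X 0 ^ 2) = 0 := by
  have h0 := phi_X0_pow a w 1
  rw [pow_one, pow_one] at h0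
  rw [map_sub, map_sub, map_mul, map_mul, map_mul, map_pow, phi_X0_pow, phi_X1, phi_C, phi_C, h0,
    pow_two (⟨0, 1⟩ : QuadraticAlgebra _ _ _)]
  ext1 <;> simp

noncomputable def FF (a w : k) (i : ℕ) : MvPolynomial (Fin 2) k →ₗ[k] k where
  toFun p := (phi a w p).re.coeff i
  map_add' p q := by simp
  map_smul' r p := by simp

noncomputable def GG (a w : k) (i : ℕ) : MvPolynomial (Fin 2) k →ₗ[k] k where
  toFun p := (phi a w p).im.coeff i
  map_add' p q := by simp
  map_smul' r p := by simp

lemma phi_mem (a w : k) (t : ℕ) (p : MvPolynomial (Fin 2) k)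
    (hp : p ∈ Ideal.span ({X 1 ^ 2 - C a * X 0 * X 1 - C w * X 0 ^ 2, X 0 ^ t * X 1} :
      Set (MvPolynomial (Fin 2) k))) :
    (Polynomial.X ^ (t + 2) ∣ (phi a w p).re) ∧ (Polynomial.X ^ t ∣ (phi a w p).im) := by
  obtain ⟨u, v, rfl⟩ := Ideal.mem_span_pair.1 hp
  rw [map_add, map_mul, phi_Q, mul_zero, zero_add, map_mul, map_mul, phi_X0_pow, phi_X1]
  constructor
  · refine ⟨Polynomial.C w * (phi a w v).im, ?_⟩
    simp
    ring
  · refine ⟨(phi a w v).re + (phi a w v).im * (Polynomial.C a * Polynomial.X), ?_⟩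
    simp
    ring

lemma FF_mem (a w : k) (t i : ℕ) (hi : i ≤ t + 1) (p : MvPolynomial (Fin 2) k)
    (hp : p ∈ Ideal.span ({X 1 ^ 2 - C a * X 0 * X 1 - C w * X 0 ^ 2, X 0 ^ t * X 1} :
      Set (MvPolynomial (Fin 2) k))) : FF a w i p = 0 :=
  Polynomial.X_pow_dvd_iff.1 (phi_mem a w t p hp).1 i (by omega)

lemma GG_mem (a w : k) (t i : ℕ) (hi : i < t) (p : MvPolynomial (Fin 2) k)
    (hp : p ∈ Ideal.span ({X 1 ^ 2 - C a * X 0 * X 1 - C w * X 0 ^ 2, X 0 ^ t * X 1} :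
      Set (MvPolynomial (Fin 2) k))) : GG a w i p = 0 :=
  Polynomial.X_pow_dvd_iff.1 (phi_mem a w t p hp).2 i hi

lemma FF_comb (a w α β : k) (n : ℕ) :
    FF a w (n + 1) (C α * X 0 ^ (n + 1) + C β * (X 0 ^ n * X 1)) = α := by
  simp only [FF, LinearMap.coe_mk, AddHom.coe_mk, map_add, map_mul, phi_X0_pow, phi_X1, phi_C]
  simp

lemma GG_comb (a w α β : k) (n : ℕ) :
    GG a w n (C α * X 0 ^ (n + 1) + C β * (X 0 ^ n * X 1)) = β := by
  simp only [GG, LinearMap.coe_mk, AddHom.coe_mk, map_add, map_mul, phi_X0_pow, phi_X1, phi_C]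
  simp

lemma FF_C (a w α : k) : FF a w 0 (C α) = α := by
  simp only [FF, LinearMap.coe_mk, AddHom.coe_mk, phi_C, Polynomial.coeff_C_zero]

lemma comb_homog (α β : k) (n : ℕ) :
    (C α * X 0 ^ (n + 1) + C β * (X 0 ^ n * X 1) : MvPolynomial (Fin 2) k) ∈
      homogeneousSubmodule (Fin 2) k (n + 1) := by
  rw [mem_homogeneousSubmodule]
  exact ((isHomogeneous_X_pow 0 (n + 1)).C_mul α).add
    (((isHomogeneous_X_pow 0 n).mul (isHomogeneous_X k 1)).C_mul β)

lemma dvd_of_prime_aux {R : Type*} [CommRing R] [IsDomain R] {π Q r : R} (hπ : Prime π)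
    (hQ : ¬ π ∣ Q) (h : Q ∣ π * r) : Q ∣ r := by
  obtain ⟨c, hc⟩ := h
  rcases hπ.dvd_or_dvd (Dvd.intro _ hc) with h | ⟨d, rfl⟩
  · exact absurd h hQ
  · exact ⟨d, mul_left_cancel₀ hπ.ne_zero (by rw [hc]; ring)⟩

lemma regular_aux (a w : k) (hw : w ≠ 0) (t : ℕ) (ht : 2 ≤ t) :
    RingTheory.Sequence.IsRegular (MvPolynomial (Fin 2) k)
      [(X 1 ^ 2 - C a * X 0 * X 1 - C w * X 0 ^ 2 : MvPolynomial (Fin 2) k), X 0 ^ t * X 1] := by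
  have hx : ¬ (X 0 : MvPolynomial (Fin 2) k) ∣ X 1 ^ 2 - C a * X 0 * X 1 - C w * X 0 ^ 2 := by
    intro h
    have := map_dvd (aeval (![0, 1] : Fin 2 → k)) h
    simp at this
  have hy : ¬ (X 1 : MvPolynomial (Fin 2) k) ∣ X 1 ^ 2 - C a * X 0 * X 1 - C w * X 0 ^ 2 := by
    intro h
    have := map_dvd (aeval (![1, 0] : Fin 2 → k)) h
    simp [hw] at this
  have hQ0 : (X 1 ^ 2 - C a * X 0 * X 1 - C w * X 0 ^ 2 : MvPolynomial (Fin 2) k) ≠ 0 := by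
    intro h
    exact hx (h ▸ dvd_zero _)
  have key : ∀ (n : ℕ) (p : MvPolynomial (Fin 2) k),
      (X 1 ^ 2 - C a * X 0 * X 1 - C w * X 0 ^ 2) ∣ X 0 ^ n * p →
      (X 1 ^ 2 - C a * X 0 * X 1 - C w * X 0 ^ 2) ∣ p := by
    intro n
    induction n with
    | zero => intro p h; simpa using h
    | succ n ih =>
      intro p h
      have h' := ih (X 0 * p) (by rwa [← mul_assoc, ← pow_succ])
      exact dvd_of_prime_aux (X_prime (i := 0)) hx h'
  have hone : (1 : MvPolynomial (Fin 2) k) ∉ Ideal.span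
        ({X 1 ^ 2 - C a * X 0 * X 1 - C w * X 0 ^ 2, X 0 ^ t * X 1} :
          Set (MvPolynomial (Fin 2) k)) := by
    intro h1
    have := FF_mem a w t 0 (by omega) 1 h1
    rw [← C_1, FF_C] at this
    exact one_ne_zero this
  generalize (X 1 ^ 2 - C a * X 0 * X 1 - C w * X 0 ^ 2 : MvPolynomial (Fin 2) k) = Q at *
  rw [RingTheory.Sequence.isRegular_iff]
  constructor
  · rw [RingTheory.Sequence.isWeaklyRegular_cons_iff,
      RingTheory.Sequence.isWeaklyRegular_singleton_iff]
    constructor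
    · intro p q h
      exact mul_left_cancel₀ hQ0 h
    · rw [isSMulRegular_iff_right_eq_zero_of_smul]
      intro z hz
      obtain ⟨p, rfl⟩ := Submodule.Quotient.mk_surjective _ z
      rw [← Submodule.Quotient.mk_smul, Submodule.Quotient.mk_eq_zero,
        Submodule.mem_smul_pointwise_iff_exists] at hz
      obtain ⟨c, -, hc⟩ := hz
      rw [smul_eq_mul, smul_eq_mul, mul_assoc] at hc
      have hk := key t (X 1 * p) ⟨c, hc.symm⟩
      obtain ⟨d, hd⟩ := dvd_of_prime_aux (X_prime (i := 1)) hy hk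
      rw [Submodule.Quotient.mk_eq_zero, Submodule.mem_smul_pointwise_iff_exists]
      exact ⟨d, trivial, hd.symm⟩
  · intro h
    apply hone
    have h2 : (1 : MvPolynomial (Fin 2) k) ∈ (⊤ : Ideal (MvPolynomial (Fin 2) k)) :=
      trivial
    rw [h, smul_eq_mul, Ideal.mul_top] at h2
    rw [Ideal.span_insert]
    simpa using h2

end Helpers

/-- For `B = k[X₁,X₂]`, `a ∈ k`, `w ∈ k` nonzero, `t ≥ 2`,
`s = t+1` and `Q = X₂² − aX₁X₂ − wX₁²`:  `Q, X₁^t X₂` is a regular sequence, the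
Hilbert function of `B/(Q, X₁^t X₂)` is `1, 2, …, 2, 1, 0` (`2` in degrees
`1,…,t`, `1` in degree `t+1`, `0` afterwards); moreover `X₁² ∈ (Q, X₂)`, hence
`X₁^{t+2} ∈ (Q, X₁^t X₂)`. -/
theorem complete_intersection_case
    (k : Type*) [Field k] (a w : k) (hw : w ≠ 0) (t : ℕ) (ht : 2 ≤ t)
    (Q : MvPolynomial (Fin 2) k)
    (hQ : Q = X 1 ^ 2 - C a * X 0 * X 1 - C w * X 0 ^ 2) :
    RingTheory.Sequence.IsRegular (MvPolynomial (Fin 2) k) [Q, X 0 ^ t * X 1] ∧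
      (hilbFn k (Ideal.span {Q, X 0 ^ t * X 1}) 0 = 1 ∧
        (∀ j, 1 ≤ j → j ≤ t → hilbFn k (Ideal.span {Q, X 0 ^ t * X 1}) j = 2) ∧
        hilbFn k (Ideal.span {Q, X 0 ^ t * X 1}) (t + 1) = 1 ∧
        (∀ j, t + 2 ≤ j → hilbFn k (Ideal.span {Q, X 0 ^ t * X 1}) j = 0)) ∧
      X 0 ^ 2 ∈ Ideal.span ({Q, X 1} : Set (MvPolynomial (Fin 2) k)) ∧
      X 0 ^ (t + 2) ∈ Ideal.span ({Q, X 0 ^ t * X 1} : Set (MvPolynomial (Fin 2) k)) := by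
  subst hQ
  have hX0 : (X 0 ^ 2 : MvPolynomial (Fin 2) k) ∈ Ideal.span
      ({X 1 ^ 2 - C a * X 0 * X 1 - C w * X 0 ^ 2, X 1} : Set (MvPolynomial (Fin 2) k)) := by
    rw [Ideal.mem_span_pair]
    refine ⟨-C w⁻¹, C w⁻¹ * (X 1 - C a * X 0), ?_⟩
    have : (C w⁻¹ * C w : MvPolynomial (Fin 2) k) = 1 := by
      rw [← C_mul, inv_mul_cancel₀ hw, C_1]
    linear_combination X 0 ^ 2 * this
  have hX0t : (X 0 ^ (t + 2) : MvPolynomial (Fin 2) k) ∈ Ideal.span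
      ({X 1 ^ 2 - C a * X 0 * X 1 - C w * X 0 ^ 2, X 0 ^ t * X 1} :
        Set (MvPolynomial (Fin 2) k)) := by
    rw [Ideal.mem_span_pair] at hX0 ⊢
    obtain ⟨u, v, h⟩ := hX0
    exact ⟨X 0 ^ t * u, v, by linear_combination X 0 ^ t * h⟩
  refine ⟨regular_aux a w hw t ht, ⟨?_, ?_, ?_, ?_⟩, hX0, hX0t⟩
  all_goals
    set I := Ideal.span ({X 1 ^ 2 - C a * X 0 * X 1 - C w * X 0 ^ 2, X 0 ^ t * X 1} :
      Set (MvPolynomial (Fin 2) k)) with hI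
    have hQI : ∀ p : MvPolynomial (Fin 2) k,
        X 1 ^ 2 - C a * X 0 * X 1 - C w * X 0 ^ 2 ∣ p → p ∈ I := fun p h =>
      Ideal.mem_of_dvd _ h (Ideal.subset_span (by simp))
    have hyI : (X 0 ^ t * X 1 : MvPolynomial (Fin 2) k) ∈ I := Ideal.subset_span (by simp)
  · rw [hilbFn_eq_of_map k I 0 (FF a w 0), Module.finrank_self]
    · intro p hp
      refine ⟨FF_mem a w t 0 (by omega) p, fun h => ?_⟩
      obtain ⟨α, rfl⟩ := homog_zero p hp
      rw [FF_C] at h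
      simp [h]
    · intro v
      exact ⟨C v, isHomogeneous_C _ _, FF_C a w v⟩
  · intro j hj1 hjt
    obtain ⟨n, rfl⟩ : ∃ n, j = n + 1 := ⟨j - 1, by omega⟩
    rw [hilbFn_eq_of_map k I (n + 1) ((FF a w (n + 1)).prod (GG a w n))]
    · simp
    · intro p hp
      have hF := FF_mem a w t (n + 1) (by omega)
      have hG := GG_mem a w t n (by omega)
      refine ⟨fun h => by simp [hF p h, hG p h], fun h => ?_⟩
      obtain ⟨α, β, hd⟩ := homog_decomp a w n p hp
      have hF' := hF _ (hQI _ hd)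
      have hG' := hG _ (hQI _ hd)
      rw [LinearMap.prod_apply, Function.prod_apply, Prod.mk_eq_zero] at h
      rw [map_sub, FF_comb, h.1, zero_sub, neg_eq_zero] at hF'
      rw [map_sub, GG_comb, h.2, zero_sub, neg_eq_zero] at hG'
      apply hQI
      simpa [hF', hG'] using hd
    · rintro ⟨α, β⟩
      exact ⟨_, comb_homog α β n, by simp only [LinearMap.prod_apply, Function.prod_apply, FF_comb, GG_comb]⟩
  · rw [hilbFn_eq_of_map k I (t + 1) (FF a w (t + 1)), Module.finrank_self]
    · intro p hp
      have hF := FF_mem a w t (t + 1) le_rfl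
      refine ⟨hF p, fun h => ?_⟩
      obtain ⟨α, β, hd⟩ := homog_decomp a w t p hp
      have hF' := hF _ (hQI _ hd)
      rw [map_sub, FF_comb, h, zero_sub, neg_eq_zero] at hF'
      have h1 := I.add_mem (hQI _ hd) (I.mul_mem_left (C β) hyI)
      simpa [hF'] using h1
    · intro v
      exact ⟨_, comb_homog v 0 t, FF_comb a w v 0 t⟩
  · intro j hj
    obtain ⟨n, rfl⟩ : ∃ n, j = t + n + 1 + 1 := ⟨j - t - 2, by omega⟩
    rw [hilbFn_eq_of_map k I _ (0 : MvPolynomial (Fin 2) k →ₗ[k] PUnit)]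
    · exact Module.finrank_zero_of_subsingleton
    · intro p hp
      refine ⟨fun _ => rfl, fun _ => ?_⟩
      obtain ⟨α, β, hd⟩ := homog_decomp a w _ p hp
      have h1 := I.add_mem (hQI _ hd) (I.add_mem (I.mul_mem_left (C α * X 0 ^ n) hX0t)
        (I.mul_mem_left (C β * X 0 ^ (n + 1)) hyI))
      convert h1 using 1
      ring
    · intro v
      exact ⟨0, Submodule.zero_mem _, rfl⟩
end

section
/- Let T be a two-dimensional regular local ring with maximal ideal n = (x₁, x₂) and residue field k, let t ≥ 2, s ≥ t+1, a ∈ T, w a unit of T, and q = x₂² − a x₁ x₂ − w x₁^{s−t+1}. If λ x₁^t + μ x₁^{t−1} x₂ ∈ (q) + n^{t+1} for λ, μ ∈ T, then λ, μ ∈ n. In other words, the images of x₁^t and x₁^{t−1}x₂ in n^t/((q) + n^{t+1}) are k-linearly independent. -/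
open IsLocalRing

/-- In a local Noetherian domain with a prime strictly between `0` and the maximal ideal, the
maximal ideal is not contained in the radical of a principal proper ideal. -/
theorem aux_not_le_radical {D : Type*} [CommRing D] [IsDomain D] [IsLocalRing D]
    [IsNoetherianRing D] (p : Ideal D) (hp : p.IsPrime) (hp0 : p ≠ ⊥)
    (hpn : p < maximalIdeal D) (c : D) (hc : c ∈ maximalIdeal D) :
    ¬ maximalIdeal D ≤ (Ideal.span {c}).radical := by
  intro h
  have hmin : maximalIdeal D ∈ (Ideal.span {c}).minimalPrimes := by
    refine ⟨⟨inferInstance, (Ideal.span_singleton_le_iff_mem _).2 hc⟩, ?_⟩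
    rintro r ⟨hr, hcr⟩ -
    exact h.trans (hr.radical_le_iff.2 hcr)
  have h1 := Ideal.height_le_one_of_isPrincipal_of_mem_minimalPrimes (Ideal.span {c}) _ hmin
  have h2 : p.height < 1 := Ideal.height_le_iff.1 h1 p hp hpn
  have h3 : p.height ≤ (0 : ℕ) := by
    rw [Order.lt_one_iff] at h2
    simp [h2]
  have h4 := Ideal.height_le_iff.1 h3 ⊥ Ideal.isPrime_bot (bot_lt_iff_ne_bot.2 hp0)
  simp at h4

/-- `x₂` is a nonzerodivisor modulo `x₁`. -/
theorem aux_colon {D : Type*} [CommRing D] [IsLocalRing D] [IsNoetherianRing D]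
    (x₁ x₂ : D) (hgen : maximalIdeal D = Ideal.span {x₁, x₂})
    (hrad : ¬ maximalIdeal D ≤ (Ideal.span {x₁}).radical) (k : ℕ) (g : D)
    (hg : x₁ ∣ x₂ ^ k * g) : x₁ ∣ g := by
  let J : Ideal D :=
    { carrier := {g | ∃ k, x₁ ∣ x₂ ^ k * g}
      zero_mem' := ⟨0, by simp⟩
      add_mem' := by
        rintro u v ⟨k, hk⟩ ⟨l, hl⟩
        refine ⟨k + l, ?_⟩
        have : x₂ ^ (k + l) * (u + v) = x₂ ^ l * (x₂ ^ k * u) + x₂ ^ k * (x₂ ^ l * v) := by ring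
        rw [this]
        exact dvd_add (hk.mul_left _) (hl.mul_left _)
      smul_mem' := by
        rintro c u ⟨k, hk⟩
        refine ⟨k, ?_⟩
        have : x₂ ^ k * (c • u) = c * (x₂ ^ k * u) := by simp only [smul_eq_mul]; ring
        rw [this]
        exact hk.mul_left _ }
  have hJ : ∀ g, g ∈ J ↔ ∃ k, x₁ ∣ x₂ ^ k * g := fun g => Iff.rfl
  have hx₂ : x₂ ∈ maximalIdeal D := by rw [hgen]; exact Ideal.subset_span (by simp)
  have hle : J ≤ Ideal.span {x₁} := by
    refine Submodule.le_of_le_smul_of_le_jacobson_bot (I := maximalIdeal D)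
      (IsNoetherian.noetherian _) (maximalIdeal_le_jacobson _) ?_
    intro g hgJ
    obtain ⟨k, hk⟩ := (hJ g).1 hgJ
    have hgn : g ∈ maximalIdeal D := by
      by_contra hgn
      have hu : IsUnit g := by simpa using hgn
      have hk' : x₁ ∣ x₂ ^ k := (IsUnit.dvd_mul_right hu).1 hk
      apply hrad
      rw [hgen, Ideal.span_le]
      rintro y (rfl | rfl)
      · exact Ideal.le_radical (Ideal.mem_span_singleton_self _)
      · exact ⟨k, Ideal.mem_span_singleton.2 hk'⟩
    rw [hgen, Ideal.mem_span_pair] at hgn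
    obtain ⟨b, c, hbc⟩ := hgn
    have hc : c ∈ J := by
      refine ⟨k + 1, ?_⟩
      have : x₂ ^ (k + 1) * c = x₂ ^ k * g - x₁ * (x₂ ^ k * b) := by rw [← hbc]; ring
      rw [this]
      exact dvd_sub hk (dvd_mul_right _ _)
    rw [← hbc]
    refine Submodule.add_mem_sup (Ideal.mem_span_singleton.2 (dvd_mul_left _ _)) ?_
    rw [mul_comm c, smul_eq_mul]
    exact Ideal.mul_mem_mul hx₂ hc
  exact Ideal.mem_span_singleton.1 (hle ((hJ g).2 ⟨k, hg⟩))

/-- Linear independence of the parameters modulo the square of the maximal ideal. -/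
theorem aux_indep {D : Type*} [CommRing D] [IsLocalRing D] [IsNoetherianRing D]
    (x₁ x₂ : D) (hgen : maximalIdeal D = Ideal.span {x₁, x₂})
    (hrad : ¬ maximalIdeal D ≤ (Ideal.span {x₂}).radical) (u v : D)
    (h : u * x₁ + v * x₂ ∈ maximalIdeal D ^ 2) : u ∈ maximalIdeal D := by
  by_contra hu
  have hu : IsUnit u := by simpa using hu
  obtain ⟨u', hu'⟩ := hu.exists_left_inv
  apply hrad
  refine le_trans ?_ Ideal.le_radical
  refine Submodule.le_of_le_smul_of_le_jacobson_bot (I := maximalIdeal D)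
      (IsNoetherian.noetherian _) (maximalIdeal_le_jacobson _) ?_
  rw [smul_eq_mul, ← pow_two]
  conv_lhs => rw [hgen]
  rw [Ideal.span_le]
  rintro y (rfl | rfl)
  · have : y = (-(u' * v)) * x₂ + u' * (u * y + v * x₂) := by
      linear_combination (-y) * hu'
    rw [this]
    exact Submodule.add_mem_sup (Ideal.mem_span_singleton.2 (dvd_mul_left _ _))
      (Ideal.mul_mem_left _ _ h)
  · exact Ideal.mem_sup_left (Ideal.mem_span_singleton_self _)

theorem aux_pow {D : Type*} [CommRing D] (n : Ideal D) (x q : D)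
    (h : n ^ 2 ≤ Ideal.span {x} * n ⊔ Ideal.span {q}) (k : ℕ) :
    n ^ (k + 2) ≤ Ideal.span {x ^ k} * n ^ 2 ⊔ Ideal.span {q} := by
  induction k with
  | zero => simp
  | succ k ih =>
    have h3 : n ^ 3 ≤ Ideal.span {x} * n ^ 2 ⊔ Ideal.span {q} := by
      calc n ^ 3 = n ^ 2 * n := by ring
        _ ≤ (Ideal.span {x} * n ⊔ Ideal.span {q}) * n := Ideal.mul_mono_left h
        _ = Ideal.span {x} * n ^ 2 ⊔ Ideal.span {q} * n := by
          rw [Ideal.sup_mul, mul_assoc, pow_two]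
        _ ≤ _ := sup_le_sup_left Ideal.mul_le_left _
    calc n ^ (k + 1 + 2) = n ^ (k + 2) * n := by ring
      _ ≤ (Ideal.span {x ^ k} * n ^ 2 ⊔ Ideal.span {q}) * n := Ideal.mul_mono_left ih
      _ = Ideal.span {x ^ k} * n ^ 3 ⊔ Ideal.span {q} * n := by
        rw [Ideal.sup_mul, mul_assoc, ← pow_succ]
      _ ≤ Ideal.span {x ^ k} * (Ideal.span {x} * n ^ 2 ⊔ Ideal.span {q}) ⊔ Ideal.span {q} :=
        sup_le_sup (Ideal.mul_mono_right h3) Ideal.mul_le_left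
      _ = Ideal.span {x ^ (k + 1)} * n ^ 2 ⊔ Ideal.span {x ^ k} * Ideal.span {q}
            ⊔ Ideal.span {q} := by
        rw [Ideal.mul_sup, ← mul_assoc, Ideal.span_singleton_mul_span_singleton, pow_succ x k]
      _ ≤ _ := by
        refine sup_le (sup_le le_sup_left ?_) le_sup_right
        exact Ideal.mul_le_right.trans le_sup_right

/-- The domain case. -/
theorem aux_domain {D : Type*} [CommRing D] [IsDomain D] [IsLocalRing D] [IsNoetherianRing D]
    (x₁ x₂ : D) (hgen : maximalIdeal D = Ideal.span {x₁, x₂})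
    (p : Ideal D) (hp : p.IsPrime) (hp0 : p ≠ ⊥) (hpn : p < maximalIdeal D)
    (m r : ℕ) (a w q : D) (hq : q = x₂ ^ 2 - a * x₁ * x₂ - w * x₁ ^ (r + 2)) (lam mu : D)
    (h : lam * x₁ ^ (m + 2) + mu * x₁ ^ (m + 1) * x₂ ∈
      Ideal.span {q} + maximalIdeal D ^ (m + 3)) :
    lam ∈ maximalIdeal D ∧ mu ∈ maximalIdeal D := by
  have hx₁ : x₁ ∈ maximalIdeal D := by rw [hgen]; exact Ideal.subset_span (by simp)
  have hx₂ : x₂ ∈ maximalIdeal D := by rw [hgen]; exact Ideal.subset_span (by simp)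
  have hr₁ := aux_not_le_radical p hp hp0 hpn x₁ hx₁
  have hr₂ := aux_not_le_radical p hp hp0 hpn x₂ hx₂
  have hx0 : x₁ ≠ 0 := by
    rintro rfl
    apply hr₂
    rw [hgen, Ideal.span_le]
    rintro y (rfl | rfl)
    · exact Ideal.zero_mem _
    · exact Ideal.le_radical (Ideal.mem_span_singleton_self _)
  -- cancellation of `x₁` modulo `q`
  have hcancel : ∀ f, q ∣ x₁ * f → q ∣ f := by
    rintro f ⟨g, hg⟩
    have h1 : x₁ ∣ x₂ ^ 2 * g :=
      ⟨f + (a * x₂ + w * x₁ ^ (r + 1)) * g, by rw [hq] at hg; linear_combination -hg⟩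
    obtain ⟨g', rfl⟩ := aux_colon x₁ x₂ hgen hr₁ 2 g h1
    exact ⟨g', mul_left_cancel₀ hx0 (by rw [hg]; ring)⟩
  have hcancel' : ∀ k f, q ∣ x₁ ^ k * f → q ∣ f := by
    intro k
    induction k with
    | zero => intro f hf; simpa using hf
    | succ k ih =>
      intro f hf
      exact ih f (hcancel _ (by rwa [← mul_assoc, ← pow_succ']))
  have hqn : q ∈ maximalIdeal D ^ 2 := by
    rw [hq, pow_two (maximalIdeal D)]
    refine sub_mem (sub_mem ?_ ?_) ?_
    · rw [pow_two]; exact Ideal.mul_mem_mul hx₂ hx₂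
    · rw [mul_assoc]; exact Ideal.mul_mem_left _ _ (Ideal.mul_mem_mul hx₁ hx₂)
    · rw [pow_add, ← mul_assoc, pow_two]
      exact Ideal.mul_mem_left _ _ (Ideal.mul_mem_mul hx₁ hx₁)
  have hn2 : maximalIdeal D ^ 2 ≤ Ideal.span {x₁} * maximalIdeal D ⊔ Ideal.span {q} := by
    have key : ∀ y ∈ maximalIdeal D, x₁ * y ∈
        Ideal.span {x₁} * maximalIdeal D ⊔ Ideal.span {q} := fun y hy =>
      Ideal.mem_sup_left (Ideal.mul_mem_mul (Ideal.mem_span_singleton_self _) hy)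
    rw [pow_two, Ideal.mul_le]
    intro y hy z hz
    have hy' := hy
    rw [hgen, Ideal.mem_span_pair] at hy hz
    obtain ⟨b, c, rfl⟩ := hy
    obtain ⟨d, e, rfl⟩ := hz
    have : (b * x₁ + c * x₂) * (d * x₁ + e * x₂) =
        x₁ * (b * d * x₁ + (b * e + c * d + c * e * a) * x₂ + c * e * w * x₁ ^ r * x₁)
          + c * e * q := by
      rw [hq]; ring
    rw [this]
    refine Ideal.add_mem _ (key _ ?_)
      (Ideal.mem_sup_right (Ideal.mul_mem_left _ _ (Ideal.mem_span_singleton_self _)))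
    exact add_mem (add_mem (Ideal.mul_mem_left _ _ hx₁) (Ideal.mul_mem_left _ _ hx₂))
      (Ideal.mul_mem_left _ _ hx₁)
  have h' : lam * x₁ ^ (m + 2) + mu * x₁ ^ (m + 1) * x₂ ∈
      Ideal.span {x₁ ^ (m + 1)} * maximalIdeal D ^ 2 ⊔ Ideal.span {q} := by
    refine (sup_le le_sup_right ?_ : Ideal.span {q} ⊔ maximalIdeal D ^ (m + 3) ≤ _) h
    exact aux_pow _ _ _ hn2 (m + 1)
  obtain ⟨y, hy, z, hz, hyz⟩ := Submodule.mem_sup.1 h'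
  obtain ⟨y', hy', rfl⟩ := Ideal.mem_span_singleton_mul.1 hy
  rw [Ideal.mem_span_singleton] at hz
  have hd : q ∣ lam * x₁ + mu * x₂ - y' := by
    apply hcancel' (m + 1)
    convert hz using 1
    linear_combination -hyz
  have hfin : lam * x₁ + mu * x₂ ∈ maximalIdeal D ^ 2 := by
    have := Ideal.add_mem _ (Ideal.mem_of_dvd _ hd hqn) hy'
    simpa using this
  refine ⟨aux_indep x₁ x₂ hgen hr₂ lam mu hfin, aux_indep x₂ x₁ ?_ hr₁ mu lam ?_⟩
  · rw [hgen, Set.pair_comm]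
  · rwa [add_comm]

/-- Let `T` be a two-dimensional regular local ring with
`n = (x₁,x₂)`, `t ≥ 2`, `s ≥ t+1`, `w` a unit and
`q = x₂² − a x₁ x₂ − w x₁^{s−t+1}`.  If
`λ x₁^t + μ x₁^{t−1} x₂ ∈ (q) + n^{t+1}` then `λ, μ ∈ n`; i.e. the images of
`x₁^t` and `x₁^{t−1}x₂` in `n^t/((q)+n^{t+1})` are `k`-linearly independent. -/
theorem linear_independence_mod_q
    (T : Type*) [CommRing T] [IsLocalRing T] [IsNoetherianRing T]
    (x₁ x₂ : T) (hgen : maximalIdeal T = Ideal.span {x₁, x₂})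
    (hdim : ringKrullDim T = 2)
    (t s : ℕ) (ht : 2 ≤ t) (hs : t + 1 ≤ s)
    (a w : T) (hw : IsUnit w)
    (q : T) (hq : q = x₂ ^ 2 - a * x₁ * x₂ - w * x₁ ^ (s - t + 1)) :
    ∀ lam mu : T,
      lam * x₁ ^ t + mu * x₁ ^ (t - 1) * x₂ ∈
          Ideal.span {q} + (maximalIdeal T) ^ (t + 1) →
        lam ∈ maximalIdeal T ∧ mu ∈ maximalIdeal T := by
  intro lam mu h
  have h2 : ((2 : ℕ) : WithBot ℕ∞) ≤ Order.krullDim (PrimeSpectrum T) := by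
    change _ ≤ ringKrullDim T
    rw [hdim]; rfl
  obtain ⟨l, hl⟩ := Order.le_krullDim_iff.1 h2
  obtain ⟨P, P₁, P₂, h01, h12⟩ : ∃ P P₁ P₂ : PrimeSpectrum T, P < P₁ ∧ P₁ < P₂ :=
    ⟨l ⟨0, by omega⟩, l ⟨1, by omega⟩, l ⟨2, by omega⟩,
      l.strictMono (by simp [Fin.lt_def]), l.strictMono (by simp [Fin.lt_def])⟩
  have h01' : P.asIdeal < P₁.asIdeal := h01
  have h12' : P₁.asIdeal < maximalIdeal T :=
    lt_of_lt_of_le (show P₁.asIdeal < P₂.asIdeal from h12) (le_maximalIdeal P₂.2.ne_top)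
  have hPp := P.2
  let f := Ideal.Quotient.mk P.asIdeal
  have hf : Function.Surjective f := Ideal.Quotient.mk_surjective
  have hloc : IsLocalRing (T ⧸ P.asIdeal) := IsLocalRing.of_surjective' f hf
  have hmap : (maximalIdeal T).map f = maximalIdeal (T ⧸ P.asIdeal) :=
    map_maximalIdeal_of_surjective f hf
  have hlh : IsLocalHom f := IsLocalHom.of_surjective f hf
  have hcomap : (maximalIdeal (T ⧸ P.asIdeal)).comap f = maximalIdeal T := maximalIdeal_comap f
  have hker : RingHom.ker f ≤ P₁.asIdeal := by
    rw [Ideal.mk_ker]; exact h01'.le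
  have hc1 : (P₁.asIdeal.map f).comap f = P₁.asIdeal := by
    rw [Ideal.comap_map_of_surjective' f hf, sup_eq_left]; exact hker
  have hP₁p := P₁.2
  obtain ⟨m, rfl⟩ := Nat.exists_eq_add_of_le' ht
  obtain ⟨r, rfl⟩ := Nat.exists_eq_add_of_le hs
  have hr : m + 2 + 1 + r - (m + 2) + 1 = r + 2 := by omega
  rw [hr] at hq
  have hm : m + 2 - 1 = m + 1 := by omega
  rw [hm] at h
  have key := aux_domain (f x₁) (f x₂) (by rw [← hmap, hgen, Ideal.map_span, Set.image_pair])
    (P₁.asIdeal.map f) (Ideal.map_isPrime_of_surjective hf hker)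
    (by
      intro hbot
      rw [hbot] at hc1
      have : RingHom.ker f = P₁.asIdeal := hc1
      rw [Ideal.mk_ker] at this
      exact h01'.ne this)
    (by
      refine lt_of_le_of_ne (hmap ▸ Ideal.map_mono h12'.le) ?_
      intro heq
      rw [heq, hcomap] at hc1
      exact h12'.ne hc1.symm)
    m r (f a) (f w) (f q) (by rw [hq]; simp) (f lam) (f mu)
    (by
      have := Ideal.mem_map_of_mem f h
      rw [Submodule.add_eq_sup, Ideal.map_sup, Ideal.map_pow, hmap, Ideal.map_span,
        Set.image_singleton] at this
      simpa using this)
  rw [← hcomap]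
  exact key
end
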